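/- (Existence of a reconstruction map K and rank preservation for the prediction observation matrix.) Let A ∈ ℝ^{n_x×n_x}, B ∈ ℝ^{n_x×n_u}, C ∈ ℝ^{n_y×n_x}, D ∈ ℝ^{n_y×n_u}, 1 ≤ L₀ ≤ L, n := n_u + n_y, L' := L − L₀, and suppose the observability matrix O_{L₀} := col(C, CA, …, CA^{L₀−1}) has rank n_x. Let Φ ∈ ℝ^{(nL₀+n_uL')×nL} be the matrix that maps a stacked vector col(z_1,…,z_L) with z_t = col(u_t,y_t) to col(z_1,…,z_{L₀}, u_{L₀+1},…,u_L). Then there exists a matrix K ∈ ℝ^{nL×(nL₀+n_uL')} such that z = K·Φ·z for every stacked length-L trajectory z of (A,B,C,D); consequently, every matrix H⁰ whose columns are stacked length-L trajectories of (A,B,C,D) satisfies rank(Φ·H⁰) = rank(H⁰). -/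

import Mathlib

/-- `z : Fin L × (Fin nu ⊕ Fin ny) → ℝ` is a stacked length-`L` input-output trajectory of
the LTI system `(A, B, C, D)`. -/
def IsTrajectory {nx nu ny L : ℕ}
    (A : Matrix (Fin nx) (Fin nx) ℝ) (B : Matrix (Fin nx) (Fin nu) ℝ)
    (C : Matrix (Fin ny) (Fin nx) ℝ) (D : Matrix (Fin ny) (Fin nu) ℝ)
    (z : Fin L × (Fin nu ⊕ Fin ny) → ℝ) : Prop :=
  ∃ x : Fin L → Fin nx → ℝ,
    (∀ t : Fin L, ∀ ht : (t : ℕ) + 1 < L,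
      x ⟨(t : ℕ) + 1, ht⟩ =
        A.mulVec (x t) + B.mulVec (fun i => z (t, Sum.inl i))) ∧
    (∀ t : Fin L, (fun j => z (t, Sum.inr j)) =
        C.mulVec (x t) + D.mulVec (fun i => z (t, Sum.inl i)))

theorem Matrix.mulVec_injective_of_rank_eq {m : Type*} [Finite m] {n : ℕ}
    (M : Matrix m (Fin n) ℝ) (h : M.rank = n) : Function.Injective M.mulVec := by
  have := Fintype.ofFinite m
  rw [Matrix.mulVec_injective_iff, linearIndependent_iff_card_eq_finrank_span,
    Set.finrank, ← Matrix.rank_eq_finrank_span_cols, h, Fintype.card_fin]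

/-- The subspace of stacked length-`L` trajectories of `(A, B, C, D)`. -/
def trajectorySubmodule {nx nu ny : ℕ} (L : ℕ)
    (A : Matrix (Fin nx) (Fin nx) ℝ) (B : Matrix (Fin nx) (Fin nu) ℝ)
    (C : Matrix (Fin ny) (Fin nx) ℝ) (D : Matrix (Fin ny) (Fin nu) ℝ) :
    Submodule ℝ (Fin L × (Fin nu ⊕ Fin ny) → ℝ) where
  carrier := {z | IsTrajectory A B C D z}
  zero_mem' := by
    refine ⟨0, fun t ht => ?_, fun t => ?_⟩
    · change (0 : Fin nx → ℝ) = A.mulVec 0 + B.mulVec 0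
      simp
    · change (0 : Fin ny → ℝ) = C.mulVec 0 + D.mulVec 0
      simp
  add_mem' := by
    rintro z w ⟨x, hx, hy⟩ ⟨x', hx', hy'⟩
    refine ⟨x + x', fun t ht => ?_, fun t => ?_⟩
    · change x _ + x' _ = A.mulVec (x t + x' t) +
        B.mulVec ((fun i => z (t, Sum.inl i)) + fun i => w (t, Sum.inl i))
      rw [hx t ht, hx' t ht, Matrix.mulVec_add, Matrix.mulVec_add]
      abel
    · change (fun j => z (t, Sum.inr j)) + (fun j => w (t, Sum.inr j)) =
        C.mulVec (x t + x' t) +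
        D.mulVec ((fun i => z (t, Sum.inl i)) + fun i => w (t, Sum.inl i))
      rw [hy t, hy' t, Matrix.mulVec_add, Matrix.mulVec_add]
      abel
  smul_mem' := by
    rintro c z ⟨x, hx, hy⟩
    refine ⟨c • x, fun t ht => ?_, fun t => ?_⟩
    · change c • x _ = A.mulVec (c • x t) + B.mulVec (c • fun i => z (t, Sum.inl i))
      rw [hx t ht, Matrix.mulVec_smul, Matrix.mulVec_smul, smul_add]
    · change c • (fun j => z (t, Sum.inr j)) =
        C.mulVec (c • x t) + D.mulVec (c • fun i => z (t, Sum.inl i))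
      rw [hy t, Matrix.mulVec_smul, Matrix.mulVec_smul, smul_add]

/-- For an observable system, a trajectory with zero input whose first `L₀` outputs vanish
is zero. -/
theorem IsTrajectory.eq_zero {nx nu ny L L₀ : ℕ} (hL₀ : 1 ≤ L₀) (hL : L₀ ≤ L)
    {A : Matrix (Fin nx) (Fin nx) ℝ} {B : Matrix (Fin nx) (Fin nu) ℝ}
    {C : Matrix (Fin ny) (Fin nx) ℝ} {D : Matrix (Fin ny) (Fin nu) ℝ}
    (hobs : (Matrix.of fun (p : Fin L₀ × Fin ny) (j : Fin nx) =>
      (C * A ^ (p.1 : ℕ)) p.2 j).rank = nx)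
    {z : Fin L × (Fin nu ⊕ Fin ny) → ℝ} (hz : IsTrajectory A B C D z)
    (hu : ∀ t i, z (t, Sum.inl i) = 0)
    (hy : ∀ t : Fin L, (t : ℕ) < L₀ → ∀ j, z (t, Sum.inr j) = 0) : z = 0 := by
  obtain ⟨x, hx, hout⟩ := hz
  have hL_pos : 0 < L := by omega
  have hu' (t : Fin L) : (fun i => z (t, Sum.inl i)) = 0 := funext (hu t)
  have hstate (k : ℕ) (hk : k < L) : x ⟨k, hk⟩ = (A ^ k).mulVec (x ⟨0, hL_pos⟩) := by
    induction k with
    | zero => simp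
    | succ k ih =>
      rw [hx ⟨k, by omega⟩ hk, ih, hu', Matrix.mulVec_zero, add_zero, Matrix.mulVec_mulVec,
        ← pow_succ']
  have hx0 : x ⟨0, hL_pos⟩ = 0 := by
    apply Matrix.mulVec_injective_of_rank_eq _ hobs
    rw [Matrix.mulVec_zero]
    ext ⟨t, j⟩
    have ht : (t : ℕ) < L := t.isLt.trans_le hL
    have h := congrFun (hout ⟨t, ht⟩) j
    rw [hu', Matrix.mulVec_zero, add_zero, hstate, Matrix.mulVec_mulVec,
      hy ⟨t, ht⟩ t.isLt] at h
    exact h.symm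
  ext ⟨t, i | j⟩
  · exact hu t i
  · have h := congrFun (hout t) j
    rw [hu', hstate t t.isLt, hx0] at h
    simpa using h

/-- Existence of a reconstruction map `K` and rank preservation for the prediction
observation matrix: if the order-`L₀` observability matrix has rank `nx` and `Φ` maps a
stacked length-`L` trajectory `col(z_1,…,z_L)` to `col(z_1,…,z_{L₀},u_{L₀+1},…,u_L)`, then
there exists `K` with `z = K Φ z` for every stacked trajectory `z`; consequently
`rank (Φ H⁰) = rank H⁰` for every matrix `H⁰` whose columns are stacked trajectories. -/
theorem exists_reconstruction_map_and_rank_eq {nx nu ny L L₀ : ℕ}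
    (hL₀ : 1 ≤ L₀) (hL : L₀ ≤ L)
    (A : Matrix (Fin nx) (Fin nx) ℝ) (B : Matrix (Fin nx) (Fin nu) ℝ)
    (C : Matrix (Fin ny) (Fin nx) ℝ) (D : Matrix (Fin ny) (Fin nu) ℝ)
    (hobs : (Matrix.of fun (p : Fin L₀ × Fin ny) (j : Fin nx) =>
      (C * A ^ (p.1 : ℕ)) p.2 j).rank = nx)
    (Φ : Matrix ((Fin L₀ × (Fin nu ⊕ Fin ny)) ⊕ (Fin (L - L₀) × Fin nu))
      (Fin L × (Fin nu ⊕ Fin ny)) ℝ)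
    (hΦ : ∀ z : Fin L × (Fin nu ⊕ Fin ny) → ℝ,
      Φ.mulVec z =
        Sum.elim
          (fun p : Fin L₀ × (Fin nu ⊕ Fin ny) => z (Fin.castLE hL p.1, p.2))
          (fun p : Fin (L - L₀) × Fin nu =>
            z (⟨L₀ + (p.1 : ℕ), by have := p.1.isLt; omega⟩, Sum.inl p.2))) :
    ∃ K : Matrix (Fin L × (Fin nu ⊕ Fin ny))
        ((Fin L₀ × (Fin nu ⊕ Fin ny)) ⊕ (Fin (L - L₀) × Fin nu)) ℝ,
      (∀ z : Fin L × (Fin nu ⊕ Fin ny) → ℝ, IsTrajectory A B C D z →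
        K.mulVec (Φ.mulVec z) = z) ∧
      ∀ (M : ℕ) (H0 : Matrix (Fin L × (Fin nu ⊕ Fin ny)) (Fin M) ℝ),
        (∀ c : Fin M, IsTrajectory A B C D (fun i => H0 i c)) →
        (Φ * H0).rank = H0.rank := by
  have hinj : Function.Injective
      (Φ.mulVecLin.comp (trajectorySubmodule L A B C D).subtype) := by
    rw [injective_iff_map_eq_zero]
    rintro ⟨z, hz⟩ h
    have h0 : Φ.mulVec z = 0 := h
    rw [hΦ] at h0
    have hinit (t : Fin L) (ht : (t : ℕ) < L₀) (i) : z (t, i) = 0 :=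
      congrFun h0 (Sum.inl (⟨t, ht⟩, i))
    refine Subtype.ext (IsTrajectory.eq_zero hL₀ hL hobs hz (fun t i => ?_)
      fun t ht j => hinit t ht _)
    by_cases ht : (t : ℕ) < L₀
    · exact hinit t ht _
    · have h := congrFun h0 (Sum.inr (⟨t - L₀, by omega⟩, i))
      have ht' : L₀ + ((t : ℕ) - L₀) = t := by omega
      simpa [ht'] using h
  obtain ⟨g, hg⟩ := LinearMap.exists_leftInverse_of_injective _ (LinearMap.ker_eq_bot.2 hinj)
  have hK : ∀ z, IsTrajectory A B C D z →
      (LinearMap.toMatrix' ((trajectorySubmodule L A B C D).subtype.comp g)).mulVec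
        (Φ.mulVec z) = z := by
    intro z hz
    rw [LinearMap.toMatrix'_mulVec]
    exact congrArg Subtype.val (LinearMap.congr_fun hg ⟨z, hz⟩)
  refine ⟨_, hK, fun M H0 hH0 => le_antisymm (Matrix.rank_mul_le_right _ _) ?_⟩
  set K := LinearMap.toMatrix' ((trajectorySubmodule L A B C D).subtype.comp g)
  have hKH : K * (Φ * H0) = H0 := by
    ext i c
    exact congrFun (hK _ (hH0 c)) i
  calc H0.rank = (K * (Φ * H0)).rank := by rw [hKH]
    _ ≤ (Φ * H0).rank := Matrix.rank_mul_le_right _ _
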